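/- Let (I, δ₁, δ₂) and (I, σ₁, σ₂) be two regular P-configurations. Then there exists a unique homeomorphism h : I → I such that h(-1) = -1, h(0) = 0, h(1) = 1, and h(δᵢ(t)) = σᵢ(h(t)) for i = 1,2 and all t ∈ I. In particular, any two regular P-configurations are conjugate. -/

import Mathlib

open Set

/-- The interval `I = [-1, 1]`. -/
def Iseg : Set ℝ := Set.Icc (-1) 1

/-- `δ₁, δ₂ : I → I` (with derivative functions `d₁, d₂` on `I`) form a *regular
P-configuration* in `I = [-1,1]`: they are `C¹`, `d₁ + d₂ = 1`, both derivatives are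
strictly positive, and the endpoint conditions hold. -/
structure RegPConfig (δ₁ δ₂ d₁ d₂ : ℝ → ℝ) : Prop where
  maps₁ : MapsTo δ₁ Iseg Iseg
  maps₂ : MapsTo δ₂ Iseg Iseg
  hasDeriv₁ : ∀ t ∈ Iseg, HasDerivWithinAt δ₁ (d₁ t) Iseg t
  hasDeriv₂ : ∀ t ∈ Iseg, HasDerivWithinAt δ₂ (d₂ t) Iseg t
  contDeriv₁ : ContinuousOn d₁ Iseg
  contDeriv₂ : ContinuousOn d₂ Iseg
  derivSum : ∀ t ∈ Iseg, d₁ t + d₂ t = 1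
  derivPos₁ : ∀ t ∈ Iseg, 0 < d₁ t
  derivPos₂ : ∀ t ∈ Iseg, 0 < d₂ t
  fix₂ : δ₂ (-1) = -1
  mid₂ : δ₂ 1 = 0
  mid₁ : δ₁ (-1) = 0
  fix₁ : δ₁ 1 = 1

/-- `h` restricts to a homeomorphism of `I = [-1,1]` onto itself: it is continuous on `I`,
maps `I` into `I`, and has a continuous inverse `g : I → I`. -/
def IsHomeoOfIcc (h : ℝ → ℝ) : Prop :=
  ContinuousOn h Iseg ∧ MapsTo h Iseg Iseg ∧
    ∃ g : ℝ → ℝ, ContinuousOn g Iseg ∧ MapsTo g Iseg Iseg ∧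
      (∀ t ∈ Iseg, g (h t) = t) ∧ (∀ t ∈ Iseg, h (g t) = t)

open Topology NNReal

/-- Two injective contractions `a`, `b` of a metric space with a common constant `K`, fixing `q`
and `p` respectively, whose ranges cover the space and meet only in the point `a p = b q`. -/
structure GluedContractions {X : Type*} [MetricSpace X] (p q : X) (K : ℝ≥0) (a b : X → X) :
    Prop where
  lt_one : K < 1
  lipschitz₁ : LipschitzWith K a
  lipschitz₂ : LipschitzWith K b
  injective₁ : Function.Injective a
  injective₂ : Function.Injective b
  fixed₁ : a q = q
  fixed₂ : b p = p
  glue : a p = b q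
  eq_of_glue : ∀ x y, a x = b y → x = p ∧ y = q
  cover : ∀ z, (∃ x, a x = z) ∨ ∃ x, b x = z

namespace GluedContractions

variable {X : Type*} [MetricSpace X] {p q : X} {K L : ℝ≥0} {a b c d : X → X}

/-- Two continuous semiconjugacies between the same systems of glued contractions are equal. -/
theorem semiconj_unique [CompactSpace X] (hab : GluedContractions p q K a b)
    (hcd : GluedContractions p q L c d) {f g : X → X} (hf : Continuous f) (hg : Continuous g)
    (hf₁ : ∀ x, f (a x) = c (f x)) (hf₂ : ∀ x, f (b x) = d (f x))
    (hg₁ : ∀ x, g (a x) = c (g x)) (hg₂ : ∀ x, g (b x) = d (g x)) : f = g := by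
  obtain ⟨z, -, hz⟩ := isCompact_univ.exists_isMaxOn (f := fun x => dist (f x) (g x))
    ⟨p, mem_univ p⟩ (hf.dist hg).continuousOn
  have hle : ∀ x, dist (f x) (g x) ≤ dist (f z) (g z) := fun x => hz (mem_univ x)
  have hL : (L : ℝ) < 1 := hcd.lt_one
  have hmul : dist (f z) (g z) ≤ L * dist (f z) (g z) := by
    rcases hab.cover z with ⟨x, hx⟩ | ⟨x, hx⟩
    · calc dist (f z) (g z) = dist (c (f x)) (c (g x)) := by rw [← hx, hf₁, hg₁]
        _ ≤ L * dist (f x) (g x) := hcd.lipschitz₁.dist_le_mul _ _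
        _ ≤ L * dist (f z) (g z) := by gcongr; exact hle x
    · calc dist (f z) (g z) = dist (d (f x)) (d (g x)) := by rw [← hx, hf₂, hg₂]
        _ ≤ L * dist (f x) (g x) := hcd.lipschitz₂.dist_le_mul _ _
        _ ≤ L * dist (f z) (g z) := by gcongr; exact hle x
  have hzero : dist (f z) (g z) ≤ 0 := by
    nlinarith [dist_nonneg (x := f z) (y := g z)]
  funext x
  exact dist_le_zero.mp ((hle x).trans hzero)

theorem isQuotientMap_elim [CompactSpace X] (hab : GluedContractions p q K a b) :
    IsQuotientMap (Sum.elim a b) := by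
  have hc : Continuous (Sum.elim a b) :=
    hab.lipschitz₁.continuous.sumElim hab.lipschitz₂.continuous
  refine hc.isClosedMap.isQuotientMap hc fun z => ?_
  rcases hab.cover z with ⟨x, hx⟩ | ⟨x, hx⟩
  · exact ⟨Sum.inl x, hx⟩
  · exact ⟨Sum.inr x, hx⟩

/-- The push-forward of a map fixing `p` and `q`: it sends `a x` to `c (f x)` and `b x` to
`d (f x)`. -/
theorem exists_pushforward [CompactSpace X] (hab : GluedContractions p q K a b)
    (hcd : GluedContractions p q L c d) (f : C(X, X)) (hp : f p = p) (hq : f q = q) :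
    ∃ g : C(X, X), (g p = p ∧ g q = q) ∧
      (∀ x, g (a x) = c (f x)) ∧ ∀ x, g (b x) = d (f x) := by
  let F : C(X ⊕ X, X) := ⟨Sum.elim (c ∘ f) (d ∘ f),
    (hcd.lipschitz₁.continuous.comp f.continuous).sumElim
      (hcd.lipschitz₂.continuous.comp f.continuous)⟩
  have hF : Function.FactorsThrough F (Sum.elim a b) := by
    rintro (x | x) (y | y) h
    · rw [hab.injective₁ h]
    · obtain ⟨rfl, rfl⟩ := hab.eq_of_glue x y h
      change c (f x) = d (f y)
      rw [hp, hq, hcd.glue]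
    · obtain ⟨rfl, rfl⟩ := hab.eq_of_glue y x h.symm
      change d (f x) = c (f y)
      rw [hp, hq, hcd.glue]
    · rw [hab.injective₂ h]
  let π : C(X ⊕ X, X) := ⟨Sum.elim a b, hab.isQuotientMap_elim.continuous⟩
  have hπ : IsQuotientMap π := hab.isQuotientMap_elim
  let g : C(X, X) := hπ.lift F hF
  have hg : ∀ s, g (π s) = F s := fun s => DFunLike.congr_fun (hπ.lift_comp F hF) s
  have hg₁ : ∀ x, g (a x) = c (f x) := fun x => hg (Sum.inl x)
  have hg₂ : ∀ x, g (b x) = d (f x) := fun x => hg (Sum.inr x)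
  refine ⟨g, ⟨?_, ?_⟩, hg₁, hg₂⟩
  · have := hg₂ p
    rwa [hab.fixed₂, hp, hcd.fixed₂] at this
  · have := hg₁ q
    rwa [hab.fixed₁, hq, hcd.fixed₁] at this

theorem exists_semiconj [CompactSpace X] (hab : GluedContractions p q K a b)
    (hcd : GluedContractions p q L c d) :
    ∃ f : C(X, X), (f p = p ∧ f q = q) ∧
      (∀ x, f (a x) = c (f x)) ∧ ∀ x, f (b x) = d (f x) := by
  let S : Set C(X, X) := {f | f p = p ∧ f q = q}
  have hS : IsClosed S :=
    (isClosed_eq (continuous_eval_const p) continuous_const).inter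
      (isClosed_eq (continuous_eval_const q) continuous_const)
  have : CompleteSpace S := hS.completeSpace_coe
  have : Nonempty S := ⟨⟨ContinuousMap.id X, rfl, rfl⟩⟩
  choose T hTS hT₁ hT₂ using fun f : S => hab.exists_pushforward hcd f.1 f.2.1 f.2.2
  let Φ : S → S := fun f => ⟨T f, hTS f⟩
  have hΦ : ContractingWith L Φ := by
    refine ⟨hcd.lt_one, LipschitzWith.of_dist_le_mul fun f g => ?_⟩
    change dist (T f) (T g) ≤ L * dist f.1 g.1
    rw [ContinuousMap.dist_le (by positivity)]
    intro z
    rcases hab.cover z with ⟨x, rfl⟩ | ⟨x, rfl⟩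
    · rw [hT₁, hT₁]
      refine (hcd.lipschitz₁.dist_le_mul _ _).trans ?_
      gcongr
      exact ContinuousMap.dist_apply_le_dist x
    · rw [hT₂, hT₂]
      refine (hcd.lipschitz₂.dist_le_mul _ _).trans ?_
      gcongr
      exact ContinuousMap.dist_apply_le_dist x
  have hfix : T hΦ.fixedPoint = (hΦ.fixedPoint).1 :=
    congrArg Subtype.val hΦ.fixedPoint_isFixedPt
  refine ⟨(hΦ.fixedPoint).1, (hΦ.fixedPoint).2, fun x => ?_, fun x => ?_⟩
  · rw [← hT₁, hfix]
  · rw [← hT₂, hfix]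

end GluedContractions

theorem isCompact_Iseg : IsCompact Iseg := isCompact_Icc

instance : CompactSpace Iseg := isCompact_iff_compactSpace.mp isCompact_Iseg

theorem convex_Iseg : Convex ℝ Iseg := convex_Icc _ _

theorem neg_one_mem_Iseg : (-1 : ℝ) ∈ Iseg := left_mem_Icc.mpr (by norm_num)

theorem one_mem_Iseg : (1 : ℝ) ∈ Iseg := right_mem_Icc.mpr (by norm_num)

theorem strictMonoOn_Iseg_of_deriv_pos {f f' : ℝ → ℝ}
    (hf : ∀ t ∈ Iseg, HasDerivWithinAt f (f' t) Iseg t) (hpos : ∀ t ∈ Iseg, 0 < f' t) :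
    StrictMonoOn f Iseg :=
  strictMonoOn_of_hasDerivWithinAt_pos convex_Iseg (fun t ht => (hf t ht).continuousWithinAt)
    (fun t ht => (hf t (interior_subset ht)).mono interior_subset)
    (fun t ht => hpos t (interior_subset ht))

theorem exists_lipschitzOnWith_Iseg {f f' : ℝ → ℝ}
    (hf : ∀ t ∈ Iseg, HasDerivWithinAt f (f' t) Iseg t) (hc : ContinuousOn f' Iseg)
    (hpos : ∀ t ∈ Iseg, 0 < f' t) (hlt : ∀ t ∈ Iseg, f' t < 1) :
    ∃ K : ℝ≥0, K < 1 ∧ LipschitzOnWith K f Iseg := by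
  obtain ⟨z, hz, hmax⟩ := isCompact_Iseg.exists_isMaxOn ⟨1, one_mem_Iseg⟩ hc
  refine ⟨⟨f' z, (hpos z hz).le⟩, hlt z hz,
    convex_Iseg.lipschitzOnWith_of_nnnorm_hasDerivWithin_le hf fun t ht => ?_⟩
  change ‖f' t‖ ≤ f' z
  rw [Real.norm_of_nonneg (hpos t ht).le]
  exact hmax ht

namespace RegPConfig

variable {δ₁ δ₂ d₁ d₂ : ℝ → ℝ}

theorem exists_gluedContractions (hδ : RegPConfig δ₁ δ₂ d₁ d₂) :
    ∃ K, GluedContractions (⟨-1, neg_one_mem_Iseg⟩ : Iseg) ⟨1, one_mem_Iseg⟩ K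
      (hδ.maps₁.restrict δ₁ Iseg Iseg) (hδ.maps₂.restrict δ₂ Iseg Iseg) := by
  obtain ⟨K₁, hK₁, hL₁⟩ := exists_lipschitzOnWith_Iseg hδ.hasDeriv₁ hδ.contDeriv₁ hδ.derivPos₁
    fun t ht => by linarith [hδ.derivSum t ht, hδ.derivPos₂ t ht]
  obtain ⟨K₂, hK₂, hL₂⟩ := exists_lipschitzOnWith_Iseg hδ.hasDeriv₂ hδ.contDeriv₂ hδ.derivPos₂
    fun t ht => by linarith [hδ.derivSum t ht, hδ.derivPos₁ t ht]
  have hm₁ := strictMonoOn_Iseg_of_deriv_pos hδ.hasDeriv₁ hδ.derivPos₁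
  have hm₂ := strictMonoOn_Iseg_of_deriv_pos hδ.hasDeriv₂ hδ.derivPos₂
  refine ⟨max K₁ K₂, max_lt hK₁ hK₂, (hL₁.mapsToRestrict hδ.maps₁).weaken (le_max_left _ _),
    (hL₂.mapsToRestrict hδ.maps₂).weaken (le_max_right _ _),
    hδ.maps₁.restrict_inj.mpr hm₁.injOn, hδ.maps₂.restrict_inj.mpr hm₂.injOn,
    Subtype.ext hδ.fix₁, Subtype.ext hδ.fix₂, Subtype.ext (hδ.mid₁.trans hδ.mid₂.symm), ?_, ?_⟩
  · rintro ⟨x, hx⟩ ⟨y, hy⟩ h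
    have h : δ₁ x = δ₂ y := congrArg Subtype.val h
    have h₁ : 0 ≤ δ₁ x := hδ.mid₁ ▸ hm₁.monotoneOn neg_one_mem_Iseg hx hx.1
    have h₂ : δ₂ y ≤ 0 := hδ.mid₂ ▸ hm₂.monotoneOn hy one_mem_Iseg hy.2
    exact ⟨Subtype.ext (hm₁.injOn hx neg_one_mem_Iseg (by linarith [hδ.mid₁])),
      Subtype.ext (hm₂.injOn hy one_mem_Iseg (by linarith [hδ.mid₂]))⟩
  · rintro ⟨z, hz⟩
    rcases le_total 0 z with h | h
    · obtain ⟨x, hx, hxz⟩ := intermediate_value_Icc (by norm_num) hL₁.continuousOn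
        (show z ∈ Icc (δ₁ (-1)) (δ₁ 1) by rw [hδ.mid₁, hδ.fix₁]; exact ⟨h, hz.2⟩)
      exact Or.inl ⟨⟨x, hx⟩, Subtype.ext hxz⟩
    · obtain ⟨x, hx, hxz⟩ := intermediate_value_Icc (by norm_num) hL₂.continuousOn
        (show z ∈ Icc (δ₂ (-1)) (δ₂ 1) by rw [hδ.fix₂, hδ.mid₂]; exact ⟨hz.1, h⟩)
      exact Or.inr ⟨⟨x, hx⟩, Subtype.ext hxz⟩

end RegPConfig

/-- Extension of a self-map of `I` to the real line, constant on both sides of `I`. -/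
noncomputable def extendIseg (f : Iseg → Iseg) (t : ℝ) : ℝ :=
  f (projIcc (-1) 1 (by norm_num) t)

theorem extendIseg_of_mem (f : Iseg → Iseg) {t : ℝ} (ht : t ∈ Iseg) :
    extendIseg f t = f ⟨t, ht⟩ :=
  congrArg (fun x : Iseg => (f x : ℝ)) (projIcc_of_mem _ ht)

theorem mapsTo_extendIseg (f : Iseg → Iseg) : MapsTo (extendIseg f) Iseg Iseg :=
  fun _ _ => Subtype.coe_prop (f _)

theorem continuousOn_extendIseg {f : Iseg → Iseg} (hf : Continuous f) :
    ContinuousOn (extendIseg f) Iseg :=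
  (continuous_subtype_val.comp (hf.comp continuous_projIcc)).continuousOn

theorem leftInverse_extendIseg {f g : Iseg → Iseg} (h : Function.LeftInverse g f) :
    ∀ t ∈ Iseg, extendIseg g (extendIseg f t) = t := fun t ht => by
  rw [extendIseg_of_mem f ht, extendIseg_of_mem g (f _).2]
  exact congrArg Subtype.val (h ⟨t, ht⟩)

/-- Any two regular P-configurations are conjugate by a unique homeomorphism of `I` fixing
`-1`, `0` and `1`. -/
theorem regular_pconfigs_conjugate (δ₁ δ₂ d₁ d₂ σ₁ σ₂ e₁ e₂ : ℝ → ℝ)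
    (hδ : RegPConfig δ₁ δ₂ d₁ d₂) (hσ : RegPConfig σ₁ σ₂ e₁ e₂) :
    ∃ h : ℝ → ℝ,
      (IsHomeoOfIcc h ∧ h (-1) = -1 ∧ h 0 = 0 ∧ h 1 = 1 ∧
        (∀ t ∈ Iseg, h (δ₁ t) = σ₁ (h t)) ∧ (∀ t ∈ Iseg, h (δ₂ t) = σ₂ (h t))) ∧
      ∀ h' : ℝ → ℝ,
        (IsHomeoOfIcc h' ∧ h' (-1) = -1 ∧ h' 0 = 0 ∧ h' 1 = 1 ∧
          (∀ t ∈ Iseg, h' (δ₁ t) = σ₁ (h' t)) ∧ (∀ t ∈ Iseg, h' (δ₂ t) = σ₂ (h' t))) →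
        EqOn h' h Iseg := by
  obtain ⟨K, hK⟩ := hδ.exists_gluedContractions
  obtain ⟨L, hL⟩ := hσ.exists_gluedContractions
  obtain ⟨f, ⟨hfp, hfq⟩, hf₁, hf₂⟩ := hK.exists_semiconj hL
  obtain ⟨g, -, hg₁, hg₂⟩ := hL.exists_semiconj hK
  have hgf : Function.LeftInverse g f := congrFun <|
    hK.semiconj_unique hK (g.continuous.comp f.continuous) continuous_id
      (fun x => by simp [hf₁, hg₁]) (fun x => by simp [hf₂, hg₂]) (fun _ => rfl) (fun _ => rfl)
  have hfg : Function.LeftInverse f g := congrFun <|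
    hL.semiconj_unique hL (f.continuous.comp g.continuous) continuous_id
      (fun x => by simp [hf₁, hg₁]) (fun x => by simp [hf₂, hg₂]) (fun _ => rfl) (fun _ => rfl)
  have hneg : extendIseg f (-1) = -1 := by
    rw [extendIseg_of_mem f neg_one_mem_Iseg, hfp]
  have hone : extendIseg f 1 = 1 := by
    rw [extendIseg_of_mem f one_mem_Iseg, hfq]
  have hconj₁ : ∀ t ∈ Iseg, extendIseg f (δ₁ t) = σ₁ (extendIseg f t) := fun t ht => by
    rw [extendIseg_of_mem f ht, extendIseg_of_mem f (hδ.maps₁ ht)]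
    exact congrArg Subtype.val (hf₁ ⟨t, ht⟩)
  have hconj₂ : ∀ t ∈ Iseg, extendIseg f (δ₂ t) = σ₂ (extendIseg f t) := fun t ht => by
    rw [extendIseg_of_mem f ht, extendIseg_of_mem f (hδ.maps₂ ht)]
    exact congrArg Subtype.val (hf₂ ⟨t, ht⟩)
  have hzero : extendIseg f 0 = 0 := by
    have := hconj₁ (-1) neg_one_mem_Iseg
    rwa [hneg, hδ.mid₁, hσ.mid₁] at this
  refine ⟨extendIseg f, ⟨⟨continuousOn_extendIseg f.continuous, mapsTo_extendIseg f,
    extendIseg g, continuousOn_extendIseg g.continuous, mapsTo_extendIseg g,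
    leftInverse_extendIseg hgf, leftInverse_extendIseg hfg⟩,
    hneg, hzero, hone, hconj₁, hconj₂⟩, ?_⟩
  rintro h' ⟨⟨hc, hm, -⟩, -, -, -, hh₁, hh₂⟩ t ht
  have heq : hm.restrict h' Iseg Iseg = f :=
    hK.semiconj_unique hL (hc.mapsToRestrict hm) f.continuous
      (fun x => Subtype.ext (hh₁ x x.2)) (fun x => Subtype.ext (hh₂ x x.2)) hf₁ hf₂
  rw [extendIseg_of_mem f ht, ← heq]
  rfl
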